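/- Let K ⊂ H⁺(y₀)×X be an isolated invariant set admitting a strongly admissible isolating neighborhood, let (A,R) be an attractor–repeller decomposition of K, and let (N₁,N₂,N₃) be an index triple for (y₀,K,A,R). Then (N₁,N₂) is an index pair for (y₀,R). -/

import Mathlib

open Filter Topology Set
open scoped NNReal ENNReal

noncomputable section

/-- A partial semiflow on a topological space `Z`. The value `none` plays the role of the
symbol `◊` ("undefined").  Time is modelled by `ℝ≥0`. -/
structure PartialSemiflow (Z : Type*) [TopologicalSpace Z] where
  /-- The (partially defined) flow map. -/
  flow : ℝ≥0 → Z → Option Z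
  /-- The domain of definition is open in `[0,∞) × Z`. -/
  isOpen_dom : IsOpen {p : ℝ≥0 × Z | (flow p.1 p.2).isSome = true}
  /-- The flow is continuous on its domain of definition. -/
  continuous_flow : ∀ V : Set Z, IsOpen V →
    IsOpen {p : ℝ≥0 × Z | ∃ z ∈ V, flow p.1 p.2 = some z}
  /-- `z π 0 = z`. -/
  flow_zero : ∀ z, flow 0 z = some z
  /-- The semigroup property; `◊ π t = ◊` is built into `Option.bind`. -/
  flow_add : ∀ (t₁ t₂ : ℝ≥0) (z : Z), flow (t₁ + t₂) z = (flow t₁ z).bind (flow t₂)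

namespace PartialSemiflow

variable {Z : Type*} [TopologicalSpace Z] (π : PartialSemiflow Z)

/-- `π.mem t z M` means: `z π t` is defined and belongs to `M`. -/
def mem (t : ℝ≥0) (z : Z) (M : Set Z) : Prop := ∃ w ∈ M, π.flow t z = some w

/-- `π.segMem t z M` means `z π [0,t] ⊆ M`. -/
def segMem (t : ℝ≥0) (z : Z) (M : Set Z) : Prop := ∀ s ≤ t, π.mem s z M

/-- A full solution `u : ℝ → Z` of the semiflow. -/
def IsSolution (u : ℝ → Z) : Prop :=
  ∀ (t₀ : ℝ) (s : ℝ≥0), π.flow s (u t₀) = some (u (t₀ + (s : ℝ)))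

/-- The largest invariant subset of `N`. -/
def Inv (N : Set Z) : Set Z :=
  {z | ∃ u : ℝ → Z, π.IsSolution u ∧ (∀ t, u t ∈ N) ∧ u 0 = z}

/-- The largest negatively invariant subset of `N` (solutions on `(-∞,0]`). -/
def InvMinus (N : Set Z) : Set Z :=
  {z | ∃ u : ℝ → Z, (∀ t ≤ (0 : ℝ), u t ∈ N) ∧
    (∀ (t₀ : ℝ) (s : ℝ≥0), t₀ + (s : ℝ) ≤ 0 → π.flow s (u t₀) = some (u (t₀ + (s : ℝ)))) ∧
    u 0 = z}

/-- Strong admissibility of a set `M`: asymptotic compactness together with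
non-explosion of the semiflow in `M`. -/
def StronglyAdmissible (M : Set Z) : Prop :=
  (∀ (z : ℕ → Z) (t : ℕ → ℝ≥0),
      (∀ n, π.segMem (t n) (z n) M) →
      ∃ w : ℕ → Z, (∀ n, π.flow (t n) (z n) = some (w n)) ∧
        ∃ φ : ℕ → ℕ, StrictMono φ ∧ ∃ l : Z, Tendsto (w ∘ φ) atTop (nhds l)) ∧
  (∀ (z : Z) (t : ℝ≥0), (∀ s < t, ∃ w ∈ M, π.flow s z = some w) → (π.flow t z).isSome)

end PartialSemiflow

/-- A global (everywhere defined) semiflow on `Y`, the "translation" `y ↦ y^t`. -/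
structure GlobalSemiflow (Y : Type*) [TopologicalSpace Y] where
  /-- The translation map. -/
  trans : ℝ≥0 → Y → Y
  continuous_trans : Continuous fun p : ℝ≥0 × Y => trans p.1 p.2
  trans_zero : ∀ y, trans 0 y = y
  trans_add : ∀ (s t : ℝ≥0) (y : Y), trans (s + t) y = trans t (trans s y)

variable {X Y : Type*} [MetricSpace X] [MetricSpace Y]

/-- `π` is a skew-product semiflow over the translation semiflow `σ`:  whenever
`(y,x) π t` is defined, its first component is `y^t`. -/
def GlobalSemiflow.IsSkewProduct (σ : GlobalSemiflow Y) (π : PartialSemiflow (Y × X)) : Prop :=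
  ∀ (t : ℝ≥0) (y : Y) (x : X) (w : Y × X), π.flow t (y, x) = some w → w.1 = σ.trans t y

/-- The positive hull `H⁺(y₀)` of `y₀`. -/
def hullPlus (σ : GlobalSemiflow Y) (y₀ : Y) : Set Y :=
  closure {y | ∃ t : ℝ≥0, σ.trans t y₀ = y}

/-- The space `H⁺(y₀) × X`, as a subset of `Y × X`. -/
def extSpace (σ : GlobalSemiflow Y) (y₀ : Y) : Set (Y × X) :=
  (hullPlus σ y₀) ×ˢ (Set.univ : Set X)

/-- The map `r = r_{y₀} : [0,∞) × X → H⁺(y₀) × X`, `r(t,x) = (y₀^t, x)`. -/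
def rMap (σ : GlobalSemiflow Y) (y₀ : Y) : ℝ≥0 × X → Y × X :=
  fun p => (σ.trans p.1 y₀, p.2)

/-- The canonical semiflow `χ = χ_{y₀}` on `[0,∞) × X`:
`(t,x) χ s = (t+s, Φ(s, y₀^t, x))`. -/
def chi (σ : GlobalSemiflow Y) (π : PartialSemiflow (Y × X)) (y₀ : Y)
    (s : ℝ≥0) (p : ℝ≥0 × X) : Option (ℝ≥0 × X) :=
  (π.flow s (σ.trans p.1 y₀, p.2)).map fun w => (p.1 + s, w.2)

/-- `chiMem σ π y₀ s p M` means: `p χ s` is defined and belongs to `M`. -/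
def chiMem (σ : GlobalSemiflow Y) (π : PartialSemiflow (Y × X)) (y₀ : Y)
    (s : ℝ≥0) (p : ℝ≥0 × X) (M : Set (ℝ≥0 × X)) : Prop :=
  ∃ q ∈ M, chi σ π y₀ s p = some q

/-- `N` is an isolating neighborhood for `K` in `H⁺(y₀) × X`. -/
def IsIsolatingNbhd (σ : GlobalSemiflow Y) (π : PartialSemiflow (Y × X)) (y₀ : Y)
    (K N : Set (Y × X)) : Prop :=
  N ⊆ extSpace σ y₀ ∧ IsClosed N ∧
  (∀ z ∈ π.Inv N, N ∈ nhdsWithin z (extSpace σ y₀)) ∧ K = π.Inv N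

/-- `W` is a neighborhood of `K` in `H⁺(y₀) × X`. -/
def IsNbhdOfIn (σ : GlobalSemiflow Y) (y₀ : Y) (K W : Set (Y × X)) : Prop :=
  W ⊆ extSpace σ y₀ ∧ ∀ z ∈ K, W ∈ nhdsWithin z (extSpace (X := X) σ y₀)

/-- A basic index pair in `[0,∞) × X` relative to the semiflow `χ_{y₀}`. -/
structure IsBasicIndexPair (σ : GlobalSemiflow Y) (π : PartialSemiflow (Y × X)) (y₀ : Y)
    (N₁ N₂ : Set (ℝ≥0 × X)) : Prop where
  subset : N₂ ⊆ N₁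
  closed₁ : IsClosed N₁
  closed₂ : IsClosed N₂
  ip2 : ∀ p ∈ N₁, ∀ t : ℝ≥0, ¬ chiMem σ π y₀ t p N₁ → ∃ s ≤ t, chiMem σ π y₀ s p N₂
  ip3 : ∀ p ∈ N₂, ∀ t : ℝ≥0, ¬ chiMem σ π y₀ t p N₂ → ∃ s ≤ t, ¬ chiMem σ π y₀ s p N₁

/-- An index pair for `(y₀, K)`. -/
structure IsIndexPair (σ : GlobalSemiflow Y) (π : PartialSemiflow (Y × X)) (y₀ : Y)
    (K : Set (Y × X)) (N₁ N₂ : Set (ℝ≥0 × X)) : Prop where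
  toBasic : IsBasicIndexPair σ π y₀ N₁ N₂
  ip4 : ∃ N : Set (Y × X), IsIsolatingNbhd σ π y₀ K N ∧ π.StronglyAdmissible N ∧
    N₁ \ N₂ ⊆ rMap σ y₀ ⁻¹' N
  ip5 : ∃ W : Set (Y × X), IsNbhdOfIn σ y₀ K W ∧ rMap σ y₀ ⁻¹' W ⊆ N₁ \ N₂

/-- `N₂^{-T}(N₁) = {p ∈ N₁ : p χ s ∈ N₂ for some s ∈ [0,T]}`. -/
def backSet (σ : GlobalSemiflow Y) (π : PartialSemiflow (Y × X)) (y₀ : Y)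
    (N₁ N₂ : Set (ℝ≥0 × X)) (T : ℝ≥0) : Set (ℝ≥0 × X) :=
  {p ∈ N₁ | ∃ s ≤ T, chiMem σ π y₀ s p N₂}


/-- The relation identifying all points of `A ∩ B`, together with an extra point
(which serves as the class `[B]` even when `A ∩ B = ∅`). -/
def quotRel {Z : Type*} (A B : Set Z) : ↥A ⊕ Unit → ↥A ⊕ Unit → Prop
  | Sum.inl a, Sum.inl b => a = b ∨ ((a : Z) ∈ B ∧ (b : Z) ∈ B)
  | Sum.inl a, Sum.inr _ => (a : Z) ∈ B
  | Sum.inr _, Sum.inl b => (b : Z) ∈ B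
  | Sum.inr _, Sum.inr _ => True

/-- The pointed quotient space `A/B`. -/
def PtdQuot {Z : Type*} [TopologicalSpace Z] (A B : Set Z) : Type _ := Quot (quotRel A B)

instance {Z : Type*} [TopologicalSpace Z] (A B : Set Z) : TopologicalSpace (PtdQuot A B) :=
  inferInstanceAs (TopologicalSpace (Quot _))

/-- The base point `[B]` of `A/B`. -/
def PtdQuot.pt {Z : Type*} [TopologicalSpace Z] (A B : Set Z) : PtdQuot A B :=
  Quot.mk _ (Sum.inr ())

/-- `f : (Z, z₀) → (W, w₀)` is a pointed homotopy equivalence. -/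
def IsPointedHomotopyEquiv {Z W : Type*} [TopologicalSpace Z] [TopologicalSpace W]
    (z₀ : Z) (w₀ : W) (f : C(Z, W)) : Prop :=
  f z₀ = w₀ ∧ ∃ g : C(W, Z), g w₀ = z₀ ∧
    Nonempty (ContinuousMap.HomotopyRel (g.comp f) (ContinuousMap.id Z) {z₀}) ∧
    Nonempty (ContinuousMap.HomotopyRel (f.comp g) (ContinuousMap.id W) {w₀})

/-- There is a pointed homotopy equivalence `(Z,z₀) → (W,w₀)`. -/
def PointedHomotopyEquivalent {Z W : Type*} [TopologicalSpace Z] [TopologicalSpace W]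
    (z₀ : Z) (w₀ : W) : Prop :=
  ∃ f : C(Z, W), IsPointedHomotopyEquiv z₀ w₀ f

variable {X Y : Type*} [MetricSpace X] [MetricSpace Y]

/-- `g⁺(z) = sup{t ≥ 0 : z π [0,t] ⊆ U}`, with `sup ∅ = 0`, valued in `[0,∞]`. -/
def gPlus (π : PartialSemiflow (Y × X)) (U : Set (Y × X)) (z : Y × X) : ℝ≥0∞ :=
  ⨆ t ∈ {t : ℝ≥0 | π.segMem t z U}, (t : ℝ≥0∞)

/-- `g⁻(z) = sup{d(z π t, Inv⁻(N)) : t ∈ [0, g⁺(z)], z π t ≠ ◊}`, with `sup ∅ = 0`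
and `d(·,∅) = ∞`, valued in `[0,∞]`. -/
def gMinus (π : PartialSemiflow (Y × X)) (U N : Set (Y × X)) (z : Y × X) : ℝ≥0∞ :=
  ⨆ t ∈ {t : ℝ≥0 | (t : ℝ≥0∞) ≤ gPlus π U z},
    ⨆ w ∈ {w : Y × X | π.flow t z = some w}, EMetric.infEdist w (π.InvMinus N)

/-- The function `f(p) = sup{t₀ ≥ 0 : p χ s ∈ cl(N₁ \ N₂) for all s ∈ [0,t₀]}`,
with `sup ∅ = 0`, valued in `[0,∞]`. -/
def fTime (σ : GlobalSemiflow Y) (π : PartialSemiflow (Y × X)) (y₀ : Y)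
    (N₁ N₂ : Set (ℝ≥0 × X)) (p : ℝ≥0 × X) : ℝ≥0∞ :=
  ⨆ t₀ ∈ {t₀ : ℝ≥0 | ∀ s ≤ t₀, chiMem σ π y₀ s p (closure (N₁ \ N₂))}, (t₀ : ℝ≥0∞)

/-- The α-limit set of a full solution `u`. -/
def solAlphaLimit (u : ℝ → Y × X) : Set (Y × X) := ⋂ t : ℝ, closure (u '' Set.Iic t)

/-- The ω-limit set of a full solution `u`. -/
def solOmegaLimit (u : ℝ → Y × X) : Set (Y × X) := ⋂ t : ℝ, closure (u '' Set.Ici t)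

/-- `(A, R)` is an attractor-repeller decomposition of the isolated invariant set `K`. -/
structure IsARDecomp (σ : GlobalSemiflow Y) (π : PartialSemiflow (Y × X)) (y₀ : Y)
    (K A R : Set (Y × X)) : Prop where
  A_subset : A ⊆ K
  R_subset : R ⊆ K
  disjoint : Disjoint A R
  A_isolated : ∃ N, IsIsolatingNbhd σ π y₀ A N
  R_isolated : ∃ N, IsIsolatingNbhd σ π y₀ R N
  alternatives : ∀ u : ℝ → Y × X, π.IsSolution u → (∀ t, u t ∈ K) →
    (∀ t, u t ∈ A) ∨ (∀ t, u t ∈ R) ∨ (solAlphaLimit u ⊆ R ∧ solOmegaLimit u ⊆ A)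

/-- An index triple for `(y₀, K, A, R)`. -/
structure IsIndexTriple (σ : GlobalSemiflow Y) (π : PartialSemiflow (Y × X)) (y₀ : Y)
    (K A R : Set (Y × X)) (N₁ N₂ N₃ : Set (ℝ≥0 × X)) : Prop where
  sub32 : N₃ ⊆ N₂
  sub21 : N₂ ⊆ N₁
  pairK : IsIndexPair σ π y₀ K N₁ N₃
  pairA : IsIndexPair σ π y₀ A N₂ N₃

/-- An FM-index pair for `K` relative to `π`, restricted to `H⁺(y₀) × X`. -/
structure IsFMIndexPair (σ : GlobalSemiflow Y) (π : PartialSemiflow (Y × X)) (y₀ : Y)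
    (K N₁ N₂ : Set (Y × X)) : Prop where
  subset : N₂ ⊆ N₁
  sub_ext : N₁ ⊆ extSpace σ y₀
  closed₁ : IsClosed N₁
  closed₂ : IsClosed N₂
  isolating : IsIsolatingNbhd σ π y₀ K (closure (N₁ \ N₂))
  interior_K : ∀ z ∈ K, N₁ \ N₂ ∈ nhdsWithin z (extSpace σ y₀)
  posInv : ∀ z ∈ N₂, ∀ t : ℝ≥0, (∀ s ≤ t, π.mem s z N₁) → ∀ s ≤ t, π.mem s z N₂
  exit : ∀ z ∈ N₁, ∀ t : ℝ≥0, ¬ π.mem t z N₁ →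
    ∃ s ≤ t, (∀ s' ≤ s, π.mem s' z N₁) ∧ π.mem s z N₂


namespace PartialSemiflow

section Topological

variable {Z : Type*} [TopologicalSpace Z] {π : PartialSemiflow Z}

lemma StronglyAdmissible.mono {M N : Set Z} (hN : π.StronglyAdmissible N) (h : M ⊆ N) :
    π.StronglyAdmissible M := by
  refine ⟨fun z t hz => hN.1 z t fun n s hs => ?_, fun z t hz => hN.2 z t fun s hs => ?_⟩
  · obtain ⟨w, hw, hw'⟩ := hz n s hs
    exact ⟨w, h hw, hw'⟩
  · obtain ⟨w, hw, hw'⟩ := hz s hs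
    exact ⟨w, h hw, hw'⟩

lemma Inv_subset (M : Set Z) : π.Inv M ⊆ M := by
  rintro z ⟨u, -, huM, rfl⟩
  exact huM 0

lemma IsSolution.shift {u : ℝ → Z} (hu : π.IsSolution u) (a : ℝ) :
    π.IsSolution fun t => u (t + a) := by
  intro t s
  have := hu (t + a) s
  rwa [add_right_comm] at this

lemma IsSolution.mem_Inv {u : ℝ → Z} (hu : π.IsSolution u) {M : Set Z} (hM : ∀ t, u t ∈ M)
    (t : ℝ) : u t ∈ π.Inv M :=
  ⟨fun s => u (s + t), hu.shift t, fun _ => hM _, by simp⟩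

lemma eventually_flow_mem {t : ℝ≥0} {z w : Z} (h : π.flow t z = some w) {V : Set Z}
    (hV : V ∈ 𝓝 w) : ∀ᶠ p : ℝ≥0 × Z in 𝓝 (t, z), π.mem p.1 p.2 V := by
  obtain ⟨O, hOV, hO, hwO⟩ := mem_nhds_iff.1 hV
  filter_upwards [(π.continuous_flow O hO).mem_nhds ⟨w, hwO, h⟩] with p hp
  obtain ⟨v, hv, hv'⟩ := hp
  exact ⟨v, hOV hv, hv'⟩

lemma eventually_flow_mem_right {t : ℝ≥0} {z w : Z} (h : π.flow t z = some w) {V : Set Z}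
    (hV : V ∈ 𝓝 w) : ∀ᶠ y in 𝓝 z, π.mem t y V :=
  (Continuous.prodMk_right t).continuousAt.eventually (eventually_flow_mem h hV)

lemma tendsto_of_flow_eq {ι : Type*} {F : Filter ι} {b c : ι → Z} {t : ℝ≥0} {z w : Z}
    (hb : Tendsto b F (𝓝 z)) (h : π.flow t z = some w)
    (hc : ∀ᶠ i in F, π.flow t (b i) = some (c i)) : Tendsto c F (𝓝 w) := by
  refine tendsto_def.2 fun V hV => ?_
  filter_upwards [hb.eventually (eventually_flow_mem_right h hV), hc] with i hi hci
  obtain ⟨v, hv, hv'⟩ := hi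
  rw [hci, Option.some_inj] at hv'
  rwa [← hv'] at hv

end Topological

variable {Z : Type*} [MetricSpace Z] {π : PartialSemiflow Z}

lemma StronglyAdmissible.isCompact {M : Set Z} (hM : π.StronglyAdmissible M)
    (hc : IsClosed M) : IsCompact M := by
  refine IsSeqCompact.isCompact fun z hz => ?_
  obtain ⟨w, hw, φ, hφ, l, hl⟩ := hM.1 z (fun _ => 0) fun n s hs =>
    ⟨z n, hz n, by rw [nonpos_iff_eq_zero.1 hs, π.flow_zero]⟩
  have hwz : w = z := by
    funext n
    have := hw n
    rw [π.flow_zero, Option.some_inj] at this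
    exact this.symm
  rw [hwz] at hl
  exact ⟨l, hc.mem_of_tendsto hl (Eventually.of_forall fun n => hz _), φ, hφ, hl⟩

/-- Solution pieces on growing time intervals, staying in a closed strongly admissible set,
converge along an ultrafilter to a full solution. -/
lemma StronglyAdmissible.exists_limit_solution {M : Set Z} (hM : π.StronglyAdmissible M)
    (hc : IsClosed M) {ι : Type*} (𝒰 : Ultrafilter ι) (b : ι → ℝ → Z)
    (hbM : ∀ t, ∀ᶠ n in (𝒰 : Filter ι), b n t ∈ M)
    (hb : ∀ (t : ℝ) (s : ℝ≥0), ∀ᶠ n in (𝒰 : Filter ι), π.flow s (b n t) = some (b n (t + s))) :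
    ∃ u : ℝ → Z, π.IsSolution u ∧ (∀ t, u t ∈ M) ∧
      ∀ t, Tendsto (fun n => b n t) 𝒰 (𝓝 (u t)) := by
  have hlim : ∀ t, ∃ l ∈ M, Tendsto (fun n => b n t) 𝒰 (𝓝 l) := fun t =>
    (hM.isCompact hc).ultrafilter_le_nhds' (𝒰.map fun n => b n t) (hbM t)
  choose u huM hu using hlim
  refine ⟨u, fun t s => ?_, huM, hu⟩
  have key : ∀ r : ℝ≥0, (π.flow r (u t)).isSome → π.flow r (u t) = some (u (t + r)) := by
    intro r hr
    obtain ⟨w, hw⟩ := Option.isSome_iff_exists.1 hr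
    rw [hw, tendsto_nhds_unique (tendsto_of_flow_eq (hu t) hw (hb t r)) (hu (t + r))]
  refine key s ?_
  by_contra hs
  set S : Set ℝ≥0 := {r | ¬ (π.flow r (u t)).isSome = true} with hS
  have hSc : IsClosed S := by
    rw [← isOpen_compl_iff]
    convert π.isOpen_dom.preimage (Continuous.prodMk_left (u t)) using 1
    ext r
    simp [hS, ← Option.isSome_iff_ne_none]
  have hmem : sInf S ∈ S := hSc.csInf_mem ⟨s, hs⟩ (OrderBot.bddBelow S)
  refine hmem (hM.2 _ _ fun r hr => ?_)
  have hr' : (π.flow r (u t)).isSome := by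
    by_contra h
    exact notMem_of_lt_csInf hr (OrderBot.bddBelow S) h
  exact ⟨_, huM _, key r hr'⟩

lemma StronglyAdmissible.isClosed_Inv {M : Set Z} (hM : π.StronglyAdmissible M)
    (hc : IsClosed M) : IsClosed (π.Inv M) := by
  refine isClosed_of_closure_subset fun z hz => ?_
  obtain ⟨𝒰, h𝒰, hz⟩ := mem_closure_iff_ultrafilter.1 hz
  have hex : ∀ y : Z, ∃ v : ℝ → Z, y ∈ π.Inv M → π.IsSolution v ∧ (∀ t, v t ∈ M) ∧ v 0 = y := by
    intro y
    by_cases hy : y ∈ π.Inv M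
    · obtain ⟨v, hv⟩ := hy
      exact ⟨v, fun _ => hv⟩
    · exact ⟨fun _ => y, fun h => absurd h hy⟩
  choose v hv using hex
  have hmem : ∀ᶠ y in (𝒰 : Filter Z), y ∈ π.Inv M := h𝒰
  obtain ⟨u, hu, huM, hlim⟩ := hM.exists_limit_solution hc 𝒰 v
    (fun t => hmem.mono fun y hy => (hv y hy).2.1 t)
    (fun t s => hmem.mono fun y hy => (hv y hy).1 t s)
  refine ⟨u, hu, huM, tendsto_nhds_unique ((hlim 0).congr' ?_) (show Tendsto id _ _ from hz)⟩
  exact hmem.mono fun y hy => (hv y hy).2.2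

/-- A full solution whose forward half lies in a closed strongly admissible set has a limit
solution in that set, all of whose values are limits of the forward half. -/
lemma StronglyAdmissible.exists_forward_limit {M : Set Z} (hM : π.StronglyAdmissible M)
    (hc : IsClosed M) {u : ℝ → Z} (hu : π.IsSolution u) (huM : ∀ t, 0 ≤ t → u t ∈ M) :
    ∃ v : ℝ → Z, π.IsSolution v ∧ (∀ t, v t ∈ M) ∧
      ∀ t, Tendsto (fun n : ℕ => u (t + n)) (hyperfilter ℕ : Filter ℕ) (𝓝 (v t)) := by
  refine hM.exists_limit_solution hc (hyperfilter ℕ) (fun n t => u (t + n)) (fun t => ?_)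
    fun t s => Eventually.of_forall fun n => hu.shift n t s
  refine Nat.hyperfilter_le_atTop ?_
  obtain ⟨k, hk⟩ := exists_nat_ge (-t)
  filter_upwards [eventually_ge_atTop k] with n hn
  refine huM _ ?_
  have : (k : ℝ) ≤ n := by exact_mod_cast hn
  linarith

end PartialSemiflow

lemma rMap_mem_extSpace {X Y : Type*} [MetricSpace Y] {σ : GlobalSemiflow Y} {y₀ : Y}
    (p : ℝ≥0 × X) : rMap σ y₀ p ∈ extSpace (X := X) σ y₀ :=
  ⟨subset_closure ⟨p.1, rfl⟩, mem_univ _⟩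

section IndexTriple

variable {X Y : Type*} [MetricSpace X] [MetricSpace Y] {σ : GlobalSemiflow Y}
  {π : PartialSemiflow (Y × X)} {y₀ : Y}

lemma GlobalSemiflow.IsSkewProduct.rMap_eq_of_flow (h : σ.IsSkewProduct π) {p : ℝ≥0 × X}
    {s : ℝ≥0} {w : Y × X} (hw : π.flow s (rMap σ y₀ p) = some w) :
    chi σ π y₀ s p = some (p.1 + s, w.2) ∧ rMap σ y₀ (p.1 + s, w.2) = w := by
  constructor
  · exact congrArg (Option.map fun w : Y × X => (p.1 + s, w.2)) hw
  · have := h _ _ _ _ hw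
    exact Prod.ext (by rw [this, ← σ.trans_add]; rfl) rfl

lemma chi_add (h : σ.IsSkewProduct π) {p q : ℝ≥0 × X} {s : ℝ≥0}
    (hq : chi σ π y₀ s p = some q) (t : ℝ≥0) :
    chi σ π y₀ (s + t) p = chi σ π y₀ t q := by
  obtain ⟨w, hw, rfl⟩ := Option.map_eq_some_iff.1 hq
  have hr := (h.rMap_eq_of_flow (p := p) hw).2
  have hw' : π.flow s (σ.trans p.1 y₀, p.2) = some w := hw
  change Option.map _ (π.flow (s + t) (σ.trans p.1 y₀, p.2)) =
    Option.map _ (π.flow t (rMap σ y₀ (p.1 + s, w.2)))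
  rw [π.flow_add, hw', hr, Option.bind_some, add_assoc]

lemma IsBasicIndexPair.of_triple (h : σ.IsSkewProduct π) {N₁ N₂ N₃ : Set (ℝ≥0 × X)}
    (h₃₂ : N₃ ⊆ N₂) (h₂₁ : N₂ ⊆ N₁) (h₁₃ : IsBasicIndexPair σ π y₀ N₁ N₃)
    (h₂₃ : IsBasicIndexPair σ π y₀ N₂ N₃) : IsBasicIndexPair σ π y₀ N₁ N₂ where
  subset := h₂₁
  closed₁ := h₁₃.closed₁
  closed₂ := h₂₃.closed₁
  ip2 p hp t ht := by
    obtain ⟨s, hs, q, hq, hpq⟩ := h₁₃.ip2 p hp t ht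
    exact ⟨s, hs, q, h₃₂ hq, hpq⟩
  ip3 p hp t ht := by
    obtain ⟨s, hs, q, hq, hpq⟩ := h₂₃.ip2 p hp t ht
    have hqt : ¬ chiMem σ π y₀ (t - s) q N₃ := by
      rintro ⟨v, hv, hv'⟩
      refine ht ⟨v, h₃₂ hv, ?_⟩
      rw [← hv', ← chi_add h hpq, add_tsub_cancel_of_le hs]
    obtain ⟨s', hs', hn⟩ := h₁₃.ip3 q hq _ hqt
    refine ⟨s + s', ?_, ?_⟩
    · calc s + s' ≤ s + (t - s) := by gcongr
        _ = t := add_tsub_cancel_of_le hs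
    · rintro ⟨v, hv, hv'⟩
      exact hn ⟨v, hv, by rw [← hv', chi_add h hpq]⟩

lemma IsNbhdOfIn.mem_interior {K W : Set (Y × X)} (hW : IsNbhdOfIn σ y₀ K W) {z : Y × X}
    (hz : z ∈ K) : z ∈ interior {w | w ∈ extSpace (X := X) σ y₀ → w ∈ W} :=
  mem_interior_iff_mem_nhds.2 (mem_inf_principal.1 (hW.2 z hz))

lemma IsIsolatingNbhd.isNbhdOfIn {K N : Set (Y × X)} (h : IsIsolatingNbhd σ π y₀ K N) :
    IsNbhdOfIn σ y₀ K N :=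
  ⟨h.1, fun z hz => h.2.2.1 z (h.2.2.2 ▸ hz)⟩

lemma IsIsolatingNbhd.subset {K N : Set (Y × X)} (h : IsIsolatingNbhd σ π y₀ K N) : K ⊆ N :=
  h.2.2.2.trans_subset (PartialSemiflow.Inv_subset N)

/-- A forward orbit staying in the interior of `W`, starting in the closure of `r (N₂)`, cannot
leave a closed set containing `r (N₂ \ N₃)` if `r⁻¹ (W)` misses `N₃`. -/
lemma IsBasicIndexPair.solution_mem_of_mem_closure (h : σ.IsSkewProduct π)
    {N₂ N₃ : Set (ℝ≥0 × X)} (h₂₃ : IsBasicIndexPair σ π y₀ N₂ N₃) {K W N : Set (Y × X)}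
    (hW : IsNbhdOfIn σ y₀ K W) (hW₃ : Disjoint (rMap σ y₀ ⁻¹' W) N₃) (hN : IsClosed N)
    (hN₂ : N₂ \ N₃ ⊆ rMap σ y₀ ⁻¹' N) {u : ℝ → Y × X} (hu : π.IsSolution u)
    (huK : ∀ t, u t ∈ K) (h₀ : u 0 ∈ closure (rMap σ y₀ '' N₂)) (T : ℝ≥0) : u T ∈ N := by
  have hflow : ∀ s : ℝ≥0, π.flow s (u 0) = some (u s) := fun s => by
    simpa using hu 0 s
  by_contra hT
  have h₁ : ∀ᶠ y in 𝓝 (u 0), π.mem T y Nᶜ :=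
    PartialSemiflow.eventually_flow_mem_right (hflow T) (hN.isOpen_compl.mem_nhds hT)
  have h₂ : ∀ᶠ y in 𝓝 (u 0), ∀ s ∈ Icc (0 : ℝ≥0) T,
      π.mem s y {w | w ∈ extSpace (X := X) σ y₀ → w ∈ W} := by
    refine isCompact_Icc.eventually_forall_of_forall_eventually fun s _ => ?_
    have h₃ := PartialSemiflow.eventually_flow_mem (hflow s)
      (mem_interior_iff_mem_nhds.1 (hW.mem_interior (huK s)))
    exact (continuous_swap.tendsto (u 0, s)).eventually h₃
  obtain ⟨y, ⟨p, hp, rfl⟩, hy₁, hy₂⟩ := ((mem_closure_iff_frequently.1 h₀).and_eventually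
    (h₁.and h₂)).exists
  have hp₃ : ∀ s ≤ T, ¬ chiMem σ π y₀ s p N₃ := by
    rintro s hs ⟨q, hq, hpq⟩
    obtain ⟨w, hw, hflow⟩ := hy₂ s ⟨zero_le, hs⟩
    obtain ⟨hchi, hr⟩ := h.rMap_eq_of_flow hflow
    obtain rfl : (p.1 + s, w.2) = q := Option.some_inj.1 (hchi.symm.trans hpq)
    refine disjoint_left.1 hW₃ ?_ hq
    rw [mem_preimage, hr]
    exact hw (hr ▸ rMap_mem_extSpace _)
  have hp₂ : chiMem σ π y₀ T p N₂ := by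
    by_contra hn
    obtain ⟨s, hs, hs'⟩ := h₂₃.ip2 p hp T hn
    exact hp₃ s hs hs'
  obtain ⟨q, hq, hpq⟩ := hp₂
  obtain ⟨w, hw, hflow⟩ := hy₁
  obtain ⟨hchi, hr⟩ := h.rMap_eq_of_flow hflow
  obtain rfl : (p.1 + T, w.2) = q := Option.some_inj.1 (hchi.symm.trans hpq)
  refine hw ?_
  rw [← hr]
  exact hN₂ ⟨hq, fun hq₃ => hp₃ T le_rfl ⟨_, hq₃, hpq⟩⟩

/-- Removing a suitable neighborhood of the attractor from an isolating neighborhood of `K`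
yields an isolating neighborhood of the repeller. -/
lemma IsARDecomp.isIsolatingNbhd_diff {K A R N O : Set (Y × X)}
    (hAR : IsARDecomp σ π y₀ K A R) (hN : IsIsolatingNbhd σ π y₀ K N)
    (hNa : π.StronglyAdmissible N) (hO : IsOpen O) (hAO : A ⊆ O)
    (hRO : Disjoint R (closure O)) : IsIsolatingNbhd σ π y₀ R (N \ O) := by
  have hclosed : IsClosed (N \ O) := hN.2.1.sdiff hO
  have hR : R = π.Inv (N \ O) := by
    obtain ⟨N', hN'⟩ := hAR.R_isolated
    apply Subset.antisymm
    · intro z hz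
      obtain ⟨u, hu, huN', rfl⟩ := hN'.2.2.2.subset hz
      refine hu.mem_Inv (fun t => ?_) 0
      have hut : u t ∈ R := hN'.2.2.2.symm.subset (hu.mem_Inv huN' t)
      exact ⟨hN.subset (hAR.R_subset hut),
        fun h => disjoint_left.1 hRO hut (subset_closure h)⟩
    · rintro z ⟨u, hu, huN, rfl⟩
      have huK : ∀ t, u t ∈ K := fun t =>
        hN.2.2.2.symm.subset (hu.mem_Inv (fun t => (huN t).1) t)
      rcases hAR.alternatives u hu huK with h | h | ⟨-, h⟩
      · exact absurd (hAO (h 0)) (huN 0).2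
      · exact h 0
      · obtain ⟨v, -, hvN, hv⟩ := (hNa.mono sdiff_subset).exists_forward_limit hclosed hu
          fun t _ => huN t
        refine absurd (hAO (h (mem_iInter.2 fun t => ?_))) (hvN 0).2
        refine mem_closure_of_tendsto (hv 0) (Nat.hyperfilter_le_atTop ?_)
        obtain ⟨k, hk⟩ := exists_nat_ge t
        filter_upwards [eventually_ge_atTop k] with n hn
        have : (k : ℝ) ≤ n := by exact_mod_cast hn
        exact mem_image_of_mem u (by simp only [mem_Ici]; linarith)
  refine ⟨sdiff_subset.trans hN.1, hclosed, fun z hz => ?_, hR⟩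
  rw [← hR] at hz
  filter_upwards [hN.isNbhdOfIn.2 z (hAR.R_subset hz), mem_nhdsWithin_of_mem_nhds
    (isClosed_closure.isOpen_compl.mem_nhds (disjoint_left.1 hRO hz))] with w hw hw'
  exact ⟨hw, fun h => hw' (subset_closure h)⟩

end IndexTriple

theorem statement_13 (σ : GlobalSemiflow Y) (π : PartialSemiflow (Y × X)) (hσπ : σ.IsSkewProduct π) (y₀ : Y)
    (K A R : Set (Y × X))
    (hiso : ∃ N, IsIsolatingNbhd σ π y₀ K N ∧ π.StronglyAdmissible N)
    (hAR : IsARDecomp σ π y₀ K A R)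
    (N₁ N₂ N₃ : Set (ℝ≥0 × X))
    (htriple : IsIndexTriple σ π y₀ K A R N₁ N₂ N₃) :
    IsIndexPair σ π y₀ R N₁ N₂ := by
  obtain ⟨h₃₂, h₂₁, ⟨hb₁₃, ⟨NK, hNK, hNKa, hNKs⟩, WK, hWK, hWKs⟩,
    ⟨hb₂₃, ⟨NA, hNA, hNAa, hNAs⟩, WA, hWA, hWAs⟩⟩ := htriple
  obtain ⟨NR, hNR⟩ := hAR.R_isolated
  refine ⟨IsBasicIndexPair.of_triple hσπ h₃₂ h₂₁ hb₁₃ hb₂₃, ?_, ?_⟩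
  · have hAc : IsClosed A := hNA.2.2.2 ▸ hNAa.isClosed_Inv hNA.2.1
    have hRc : IsClosed R := by
      have hR : R = π.Inv (NK ∩ NR) := by
        apply Subset.antisymm
        · intro z hz
          obtain ⟨u, hu, huN, rfl⟩ := hNR.2.2.2.subset hz
          exact hu.mem_Inv (M := NK ∩ NR) (fun t => ⟨hNK.subset (hAR.R_subset
            (hNR.2.2.2.symm.subset (hu.mem_Inv huN t))), huN t⟩) 0
        · rintro z ⟨u, hu, huN, rfl⟩
          exact hNR.2.2.2.symm.subset (hu.mem_Inv (fun t => (huN t).2) 0)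
      rw [hR]
      exact (hNKa.mono inter_subset_left).isClosed_Inv (hNK.2.1.inter hNR.2.1)
    obtain ⟨U, V, hU, hV, hAU, hRV, hUV⟩ := normal_separation hAc hRc hAR.disjoint
    set O : Set (Y × X) := interior {w | w ∈ extSpace (X := X) σ y₀ → w ∈ WA} ∩ U
    refine ⟨NK \ O, hAR.isIsolatingNbhd_diff hNK hNKa (isOpen_interior.inter hU)
      (fun z hz => ⟨hWA.mem_interior hz, hAU hz⟩) ?_, hNKa.mono sdiff_subset, ?_⟩
    · exact ((hUV.closure_left hV).mono (closure_mono inter_subset_right) hRV).symm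
    · rintro p ⟨hp₁, hp₂⟩
      refine ⟨hNKs ⟨hp₁, fun h => hp₂ (h₃₂ h)⟩, fun h => hp₂ ?_⟩
      exact (hWAs (interior_subset h.1 (rMap_mem_extSpace p))).1
  · refine ⟨WK \ closure (rMap σ y₀ '' N₂), ⟨sdiff_subset.trans hWK.1, fun z hz => ?_⟩, ?_⟩
    · refine inter_mem (hWK.2 z (hAR.R_subset hz))
        (mem_nhdsWithin_of_mem_nhds (isClosed_closure.isOpen_compl.mem_nhds fun hcl => ?_))
      obtain ⟨u, hu, huN, rfl⟩ := hNR.2.2.2.subset hz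
      have huA : ∀ t, 0 ≤ t → u t ∈ NA := fun t ht =>
        hb₂₃.solution_mem_of_mem_closure hσπ hWK
          (disjoint_left.2 fun p hp => (hWKs hp).2) hNA.2.1 hNAs hu
          (fun t => hAR.R_subset (hNR.2.2.2.symm.subset (hu.mem_Inv huN t))) hcl ⟨t, ht⟩
      obtain ⟨v, hv, hvA, hlim⟩ := hNAa.exists_forward_limit hNA.2.1 hu huA
      have hvR : ∀ t, v t ∈ NR := fun t =>
        hNR.2.1.mem_of_tendsto (hlim t) (Eventually.of_forall fun n => huN _)
      exact disjoint_left.1 hAR.disjoint (hNA.2.2.2.symm.subset (hv.mem_Inv hvA 0))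
        (hNR.2.2.2.symm.subset (hv.mem_Inv hvR 0))
    · rintro p ⟨hp, hp'⟩
      exact ⟨(hWKs hp).1, fun h => hp' (subset_closure (mem_image_of_mem _ h))⟩


end
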